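/- arXiv:1901.05312 — 12 statements merged into one kernel-verified Lean document; each statement's English description precedes it below -/
import Mathlib

section
/- For every integer n, the vector of coordinates of the n-th generalized Tribonacci sedenion satisfies V̂_n = (P·α^n/((α−β)(α−γ)))·α̂ + (Q·β^n/((β−α)(β−γ)))·β̂ + (R·γ^n/((γ−α)(γ−β)))·γ̂, where the right-hand side is a linear combination of the vectors α̂, β̂, γ̂ in Fin 16 → ℂ with the indicated complex scalars. -/
theorem geom_aux (a : ℂ) (ha : a ≠ 0) (f : ℤ → ℂ) (hf : ∀ n, f (n + 1) = a * f n) (n : ℤ) :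
    f n = f 0 * a ^ n := by
  induction n using Int.induction_on with
  | zero => simp
  | succ k ih => rw [hf, ih, zpow_add_one₀ ha]; ring
  | pred k ih =>
    have h := hf (-(k : ℤ) - 1)
    rw [sub_add_cancel, ih] at h
    rw [zpow_sub_one₀ ha]
    field_simp
    linear_combination -h

theorem generalized_tribonacci_sedenion_binet
    (r s t : ℂ) (ht : t ≠ 0) (V : ℤ → ℂ)
    (hV : ∀ n : ℤ, V n = r * V (n - 1) + s * V (n - 2) + t * V (n - 3))
    (α β γ : ℂ)
    (hα : α ^ 3 - r * α ^ 2 - s * α - t = 0)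
    (hβ : β ^ 3 - r * β ^ 2 - s * β - t = 0)
    (hγ : γ ^ 3 - r * γ ^ 2 - s * γ - t = 0)
    (hαβ : α ≠ β) (hαγ : α ≠ γ) (hβγ : β ≠ γ)
    (hsum : α + β + γ = r)
    (hsum2 : α * β + α * γ + β * γ = -s)
    (hprod : α * β * γ = t)
    (P Q R : ℂ)
    (hP : P = V 2 - (β + γ) * V 1 + β * γ * V 0)
    (hQ : Q = V 2 - (α + γ) * V 1 + α * γ * V 0)
    (hR : R = V 2 - (α + β) * V 1 + α * β * V 0)
    (Vhat : ℤ → Fin 16 → ℂ)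
    (hVhat : ∀ n : ℤ, ∀ i : Fin 16, Vhat n i = V (n + (i : ℕ)))
    (αhat βhat γhat : Fin 16 → ℂ)
    (hαhat : ∀ i : Fin 16, αhat i = α ^ (i : ℕ))
    (hβhat : ∀ i : Fin 16, βhat i = β ^ (i : ℕ))
    (hγhat : ∀ i : Fin 16, γhat i = γ ^ (i : ℕ)) :
    ∀ n : ℤ, Vhat n =
      (P * α ^ n / ((α - β) * (α - γ))) • αhat
      + (Q * β ^ n / ((β - α) * (β - γ))) • βhat
      + (R * γ ^ n / ((γ - α) * (γ - β))) • γhat := by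
  have h3 : ∀ n : ℤ, V (n + 3) = r * V (n + 2) + s * V (n + 1) + t * V n := by
    intro n
    have h := hV (n + 3)
    rw [show n + 3 - 1 = n + 2 by ring, show n + 3 - 2 = n + 1 by ring,
      show n + 3 - 3 = n by ring] at h
    exact h
  have hs : s = -(α * β + α * γ + β * γ) := by rw [hsum2]; ring
  subst hsum hs hprod
  have hα0 : α ≠ 0 := by rintro rfl; simp at ht
  have hβ0 : β ≠ 0 := by rintro rfl; simp at ht
  have hγ0 : γ ≠ 0 := by rintro rfl; simp at ht
  have e1 : ∀ n : ℤ, n + 1 + 2 = n + 3 := fun n => by ring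
  have e2 : ∀ n : ℤ, n + 1 + 1 = n + 2 := fun n => by ring
  have hA : ∀ n, V (n + 2) - (β + γ) * V (n + 1) + β * γ * V n = P * α ^ n := by
    intro n
    have := geom_aux α hα0 (fun n => V (n + 2) - (β + γ) * V (n + 1) + β * γ * V n)
      (by intro n; simp only [e1, e2, h3]; ring) n
    simpa [hP] using this
  have hB : ∀ n, V (n + 2) - (α + γ) * V (n + 1) + α * γ * V n = Q * β ^ n := by
    intro n
    have := geom_aux β hβ0 (fun n => V (n + 2) - (α + γ) * V (n + 1) + α * γ * V n)
      (by intro n; simp only [e1, e2, h3]; ring) n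
    simpa [hQ] using this
  have hC : ∀ n, V (n + 2) - (α + β) * V (n + 1) + α * β * V n = R * γ ^ n := by
    intro n
    have := geom_aux γ hγ0 (fun n => V (n + 2) - (α + β) * V (n + 1) + α * β * V n)
      (by intro n; simp only [e1, e2, h3]; ring) n
    simpa [hR] using this
  have d1 : α - β ≠ 0 := sub_ne_zero.2 hαβ
  have d2 : α - γ ≠ 0 := sub_ne_zero.2 hαγ
  have d3 : β - γ ≠ 0 := sub_ne_zero.2 hβγ
  have key : ∀ m : ℤ, V m = P * α ^ m / ((α - β) * (α - γ))
      + Q * β ^ m / ((β - α) * (β - γ)) + R * γ ^ m / ((γ - α) * (γ - β)) := by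
    intro m
    rw [← hA, ← hB, ← hC, ← neg_sub α β, ← neg_sub α γ, ← neg_sub β γ]
    field_simp
    ring
  intro n
  funext i
  simp only [Pi.add_apply, Pi.smul_apply, smul_eq_mul, hVhat, hαhat, hβhat, hγhat]
  rw [key, zpow_add₀ hα0, zpow_add₀ hβ0, zpow_add₀ hγ0]
  simp only [zpow_natCast]
  ring
end

section
/- For every integer n, P·α^{n+2} = α²·V_{n+2} + α·(s·V_{n+1} + t·V_n) + t·V_{n+1}, and the analogous identities Q·β^{n+2} = β²·V_{n+2} + β·(s·V_{n+1} + t·V_n) + t·V_{n+1} and R·γ^{n+2} = γ²·V_{n+2} + γ·(s·V_{n+1} + t·V_n) + t·V_{n+1} hold (the quadratic approximation of the generalized Tribonacci sequence). -/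
theorem quad_aux (a b c : ℂ) (ht : a * b * c ≠ 0) (V : ℤ → ℂ)
    (hV : ∀ n : ℤ, V n = (a + b + c) * V (n - 1) + (-(a * b + a * c + b * c)) * V (n - 2)
      + (a * b * c) * V (n - 3)) (n : ℤ) :
    (V 2 - (b + c) * V 1 + b * c * V 0) * a ^ (n + 2) = a ^ 2 * V (n + 2)
      + a * ((-(a * b + a * c + b * c)) * V (n + 1) + (a * b * c) * V n)
      + (a * b * c) * V (n + 1) := by
  have ha : a ≠ 0 := by rintro rfl; simp at ht
  have step : ∀ m : ℤ, V (m + 1 + 2) - (b + c) * V (m + 1 + 1) + b * c * V (m + 1)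
      = a * (V (m + 2) - (b + c) * V (m + 1) + b * c * V m) := by
    intro m
    have h := hV (m + 1 + 2)
    rw [show m + 1 + 2 - 1 = m + 2 by ring, show m + 1 + 2 - 2 = m + 1 by ring,
      show m + 1 + 2 - 3 = m by ring] at h
    rw [h, show m + 1 + 1 = m + 2 by ring]
    ring
  have key : ∀ m : ℤ, V (m + 2) - (b + c) * V (m + 1) + b * c * V m
      = (V 2 - (b + c) * V 1 + b * c * V 0) * a ^ m := by
    intro m
    induction m using Int.induction_on with
    | zero => simp
    | succ i ih => rw [step, ih, zpow_add_one₀ ha]; ring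
    | pred i ih =>
      have h := step (-(i : ℤ) - 1)
      rw [show -(i : ℤ) - 1 + 1 = -(i : ℤ) by ring, ih] at h
      apply mul_left_cancel₀ ha
      rw [show -(i : ℤ) - 1 + 1 = -(i : ℤ) by ring, ← h, zpow_sub_one₀ ha]
      field_simp
  rw [zpow_add₀ ha, ← mul_assoc, ← key n]
  norm_cast
  ring

theorem generalized_tribonacci_quadratic_approximation
    (r s t : ℂ) (ht : t ≠ 0) (V : ℤ → ℂ)
    (hV : ∀ n : ℤ, V n = r * V (n - 1) + s * V (n - 2) + t * V (n - 3))
    (α β γ : ℂ)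
    (hα : α ^ 3 - r * α ^ 2 - s * α - t = 0)
    (hβ : β ^ 3 - r * β ^ 2 - s * β - t = 0)
    (hγ : γ ^ 3 - r * γ ^ 2 - s * γ - t = 0)
    (hαβ : α ≠ β) (hαγ : α ≠ γ) (hβγ : β ≠ γ)
    (hsum : α + β + γ = r)
    (hsum2 : α * β + α * γ + β * γ = -s)
    (hprod : α * β * γ = t)
    (P Q R : ℂ)
    (hP : P = V 2 - (β + γ) * V 1 + β * γ * V 0)
    (hQ : Q = V 2 - (α + γ) * V 1 + α * γ * V 0)
    (hR : R = V 2 - (α + β) * V 1 + α * β * V 0) :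
    ∀ n : ℤ,
      P * α ^ (n + 2) = α ^ 2 * V (n + 2) + α * (s * V (n + 1) + t * V n) + t * V (n + 1)
      ∧ Q * β ^ (n + 2) = β ^ 2 * V (n + 2) + β * (s * V (n + 1) + t * V n) + t * V (n + 1)
      ∧ R * γ ^ (n + 2) = γ ^ 2 * V (n + 2) + γ * (s * V (n + 1) + t * V n) + t * V (n + 1) := by
  subst hP hQ hR
  obtain rfl : s = -(α * β + α * γ + β * γ) := by rw [hsum2]; ring
  subst hsum hprod
  intro n
  refine ⟨quad_aux α β γ ht V hV n, ?_, ?_⟩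
  · have h := quad_aux β α γ (by convert ht using 1; ring) V
      (fun m => by rw [hV m]; ring) n
    linear_combination h
  · have h := quad_aux γ α β (by convert ht using 1; ring) V
      (fun m => by rw [hV m]; ring) n
    linear_combination h
end

section
/- For every integer n, the vector V̂_n : Fin 16 → ℂ satisfies α²·V̂_{n+2} + α·(s·V̂_{n+1} + t·V̂_n) + t·V̂_{n+1} = P·α^{n+2}·α̂, together with the analogous identities in which α, P, α̂ are replaced by β, Q, β̂ and by γ, R, γ̂ (the quadratic approximation of the generalized Tribonacci sedenion). -/
theorem trib_aux (r s t : ℂ) (V : ℤ → ℂ)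
    (hV : ∀ n : ℤ, V n = r * V (n - 1) + s * V (n - 2) + t * V (n - 3))
    (a b c : ℂ) (ha : a ≠ 0)
    (h1 : a + b + c = r) (h2 : a * b + a * c + b * c = -s) (h3 : a * b * c = t) (n : ℤ) :
    V (n + 2) - (b + c) * V (n + 1) + b * c * V n
      = (V 2 - (b + c) * V 1 + b * c * V 0) * a ^ n := by
  have step : ∀ m : ℤ, V (m + 1 + 2) - (b + c) * V (m + 1 + 1) + b * c * V (m + 1)
      = a * (V (m + 2) - (b + c) * V (m + 1) + b * c * V m) := by
    intro m
    have h := hV (m + 1 + 2)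
    rw [show m + 1 + 2 - 1 = m + 2 by ring, show m + 1 + 2 - 2 = m + 1 by ring,
      show m + 1 + 2 - 3 = m by ring] at h
    have hs : s = -(a * b + a * c + b * c) := by rw [h2]; ring
    rw [h, show m + 1 + 1 = m + 2 by ring, ← h1, ← h3, hs]
    ring
  induction n using Int.induction_on with
  | zero => simp
  | succ k ih => rw [step, ih, zpow_add_one₀ ha]; ring
  | pred k ih =>
    have h := step (-(k : ℤ) - 1)
    rw [show -(k : ℤ) - 1 + 1 = -(k : ℤ) by ring, ih] at h
    rw [show -(k : ℤ) - 1 + 1 = -(k : ℤ) by ring]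
    apply mul_left_cancel₀ ha
    rw [← h, zpow_sub_one₀ ha]
    field_simp

theorem trib_aux2 (r s t : ℂ) (ht : t ≠ 0) (V : ℤ → ℂ)
    (hV : ∀ n : ℤ, V n = r * V (n - 1) + s * V (n - 2) + t * V (n - 3))
    (a b c : ℂ)
    (h1 : a + b + c = r) (h2 : a * b + a * c + b * c = -s) (h3 : a * b * c = t)
    (Vhat : ℤ → Fin 16 → ℂ)
    (hVhat : ∀ n : ℤ, ∀ i : Fin 16, Vhat n i = V (n + (i : ℕ)))
    (ahat : Fin 16 → ℂ) (hahat : ∀ i : Fin 16, ahat i = a ^ (i : ℕ)) (n : ℤ) :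
    a ^ 2 • Vhat (n + 2) + a • (s • Vhat (n + 1) + t • Vhat n) + t • Vhat (n + 1)
        = ((V 2 - (b + c) * V 1 + b * c * V 0) * a ^ (n + 2)) • ahat := by
  have ha : a ≠ 0 := by
    rintro rfl
    apply ht
    rw [← h3]; ring
  funext i
  have h := trib_aux r s t V hV a b c ha h1 h2 h3 (n + (i : ℕ))
  have hs : s = -(a * b + a * c + b * c) := by rw [h2]; ring
  simp only [Pi.add_apply, Pi.smul_apply, smul_eq_mul, hVhat, hahat]
  rw [show n + 2 + ((i : ℕ) : ℤ) = n + (i : ℕ) + 2 by ring,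
    show n + 1 + ((i : ℕ) : ℤ) = n + (i : ℕ) + 1 by ring]
  rw [zpow_add₀ ha, zpow_natCast] at h
  rw [zpow_add₀ ha, show a ^ (2 : ℤ) = a ^ 2 from zpow_natCast a 2, ← h3, hs]
  linear_combination a ^ 2 * h

theorem generalized_tribonacci_sedenion_quadratic_approximation
    (r s t : ℂ) (ht : t ≠ 0) (V : ℤ → ℂ)
    (hV : ∀ n : ℤ, V n = r * V (n - 1) + s * V (n - 2) + t * V (n - 3))
    (α β γ : ℂ)
    (hα : α ^ 3 - r * α ^ 2 - s * α - t = 0)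
    (hβ : β ^ 3 - r * β ^ 2 - s * β - t = 0)
    (hγ : γ ^ 3 - r * γ ^ 2 - s * γ - t = 0)
    (hαβ : α ≠ β) (hαγ : α ≠ γ) (hβγ : β ≠ γ)
    (hsum : α + β + γ = r)
    (hsum2 : α * β + α * γ + β * γ = -s)
    (hprod : α * β * γ = t)
    (P Q R : ℂ)
    (hP : P = V 2 - (β + γ) * V 1 + β * γ * V 0)
    (hQ : Q = V 2 - (α + γ) * V 1 + α * γ * V 0)
    (hR : R = V 2 - (α + β) * V 1 + α * β * V 0)
    (Vhat : ℤ → Fin 16 → ℂ)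
    (hVhat : ∀ n : ℤ, ∀ i : Fin 16, Vhat n i = V (n + (i : ℕ)))
    (αhat βhat γhat : Fin 16 → ℂ)
    (hαhat : ∀ i : Fin 16, αhat i = α ^ (i : ℕ))
    (hβhat : ∀ i : Fin 16, βhat i = β ^ (i : ℕ))
    (hγhat : ∀ i : Fin 16, γhat i = γ ^ (i : ℕ)) :
    ∀ n : ℤ,
      α ^ 2 • Vhat (n + 2) + α • (s • Vhat (n + 1) + t • Vhat n) + t • Vhat (n + 1)
        = (P * α ^ (n + 2)) • αhat
      ∧ β ^ 2 • Vhat (n + 2) + β • (s • Vhat (n + 1) + t • Vhat n) + t • Vhat (n + 1)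
        = (Q * β ^ (n + 2)) • βhat
      ∧ γ ^ 2 • Vhat (n + 2) + γ • (s • Vhat (n + 1) + t • Vhat n) + t • Vhat (n + 1)
        = (R * γ ^ (n + 2)) • γhat := by
  intro n
  subst hP hQ hR
  refine ⟨trib_aux2 r s t ht V hV α β γ hsum hsum2 hprod Vhat hVhat αhat hαhat n,
    trib_aux2 r s t ht V hV β α γ (by rw [← hsum]; ring) (by rw [← hsum2]; ring)
      (by rw [← hprod]; ring) Vhat hVhat βhat hβhat n,
    trib_aux2 r s t ht V hV γ α β (by rw [← hsum]; ring) (by rw [← hsum2]; ring)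
      (by rw [← hprod]; ring) Vhat hVhat γhat hγhat n⟩
end

section
/- For every integer n ≥ 1, K_n = 3·T_{n+1} − 2·T_n − T_{n−1}. -/
theorem tribonacci_lucas_in_terms_of_tribonacci
    (T K : ℤ → ℤ)
    (hT : ∀ n : ℤ, T n = T (n - 1) + T (n - 2) + T (n - 3))
    (hT0 : T 0 = 0) (hT1 : T 1 = 1) (hT2 : T 2 = 1)
    (hK : ∀ n : ℤ, K n = K (n - 1) + K (n - 2) + K (n - 3))
    (hK0 : K 0 = 3) (hK1 : K 1 = 1) (hK2 : K 2 = 3) :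
    ∀ n : ℤ, 1 ≤ n → K n = 3 * T (n + 1) - 2 * T n - T (n - 1) := by
  have hT3 := hT 3
  have hT4 := hT 4
  have hK3 := hK 3
  norm_num at hT3 hT4 hK3
  have key : ∀ m : ℕ, (K (m + 1) = 3 * T (m + 2) - 2 * T (m + 1) - T m) ∧
      (K (m + 2) = 3 * T (m + 3) - 2 * T (m + 2) - T (m + 1)) ∧
      (K (m + 3) = 3 * T (m + 4) - 2 * T (m + 3) - T (m + 2)) := by
    intro m
    induction m with
    | zero =>
      norm_num
      refine ⟨?_, ?_, ?_⟩ <;> linarith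
    | succ k ih =>
      obtain ⟨h1, h2, h3⟩ := ih
      have a := hK (k + 4)
      have b := hT (k + 5)
      have c := hT (k + 4)
      have d := hT (k + 3)
      push_cast
      ring_nf at *
      refine ⟨?_, ?_, ?_⟩ <;> linarith
  intro n hn
  obtain ⟨m, hm⟩ := Int.eq_ofNat_of_zero_le (show 0 ≤ n - 1 by omega)
  have h := (key m).1
  rw [← hm] at h
  ring_nf at h ⊢
  exact h
end

section
/- For all integers n ≥ 0 and m ≥ 3, K_{m+n} = K_{n−1}·T_{m+2} + (T_{m+1} + T_m)·K_{n−2} + K_{n−3}·T_{m+1}. -/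
theorem tribonacci_lucas_addition_formula_first
    (T K : ℤ → ℤ)
    (hT : ∀ n : ℤ, T n = T (n - 1) + T (n - 2) + T (n - 3))
    (hT0 : T 0 = 0) (hT1 : T 1 = 1) (hT2 : T 2 = 1)
    (hK : ∀ n : ℤ, K n = K (n - 1) + K (n - 2) + K (n - 3))
    (hK0 : K 0 = 3) (hK1 : K 1 = 1) (hK2 : K 2 = 3) :
    ∀ n m : ℤ, 0 ≤ n → 3 ≤ m →
      K (m + n) = K (n - 1) * T (m + 2) + (T (m + 1) + T m) * K (n - 2)
        + K (n - 3) * T (m + 1) := by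
  intro n m _ hm
  have key : ∀ k : ℕ, ∀ j : ℤ, (j = k ∨ j = k + 1 ∨ j = k + 2) →
      K (j + n) = K (n - 1) * T (j + 2) + (T (j + 1) + T j) * K (n - 2)
        + K (n - 3) * T (j + 1) := by
    have T3 : T 3 = 2 := by have := hT 3; norm_num at this; linarith
    have T4 : T 4 = 4 := by have := hT 4; norm_num at this; linarith
    have a0 := hK n
    have a1 := hK (n + 1)
    have a2 := hK (n + 2)
    rw [show n + 1 - 1 = n by ring, show n + 1 - 2 = n - 1 by ring,
      show n + 1 - 3 = n - 2 by ring] at a1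
    rw [show n + 2 - 1 = n + 1 by ring, show n + 2 - 2 = n by ring,
      show n + 2 - 3 = n - 1 by ring] at a2
    intro k
    induction k with
    | zero =>
      rintro j (rfl | rfl | rfl)
      · norm_num [hT0, hT1, hT2]; linarith
      · norm_num [hT1, hT2, T3]; rw [add_comm 1 n]; linarith
      · norm_num [hT2, T3, T4]; rw [add_comm 2 n]; linarith
    | succ k ih =>
      intro j hj
      push_cast at hj
      by_cases h : j = k + 3
      · have h1 := ih (j - 1) (by omega)
        have h2 := ih (j - 2) (by omega)
        have h3 := ih (j - 3) (by omega)
        have b := hK (j + n)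
        have c0 := hT j
        have c1 := hT (j + 1)
        have c2 := hT (j + 2)
        ring_nf at *
        rw [b, h1, h2, h3, c2, c1, c0]
        ring
      · exact ih j (by omega)
  exact key m.toNat m (by omega)
end

section
/- For all integers n ≥ 0 and m ≥ 3, K_{m+n} = K_{m+2}·T_{n−1} + (K_{m+1} + K_m)·T_{n−2} + K_{m+1}·T_{n−3}. -/
theorem tribonacci_lucas_addition_formula_second
    (T K : ℤ → ℤ)
    (hT : ∀ n : ℤ, T n = T (n - 1) + T (n - 2) + T (n - 3))
    (hT0 : T 0 = 0) (hT1 : T 1 = 1) (hT2 : T 2 = 1)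
    (hK : ∀ n : ℤ, K n = K (n - 1) + K (n - 2) + K (n - 3))
    (hK0 : K 0 = 3) (hK1 : K 1 = 1) (hK2 : K 2 = 3) :
    ∀ n m : ℤ, 0 ≤ n → 3 ≤ m →
      K (m + n) = K (m + 2) * T (n - 1) + (K (m + 1) + K m) * T (n - 2)
        + K (m + 1) * T (n - 3) := by
  intro n m hn _
  have a1 : T (-1) = 0 := by have := hT 2; norm_num at this; linarith
  have a2 : T (-2) = 1 := by have := hT 1; norm_num at this; linarith
  have a3 : T (-3) = -1 := by have := hT 0; norm_num at this; linarith
  lift n to ℕ using hn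
  induction n using Nat.strong_induction_on with
  | _ n ih =>
    match n, ih with
    | 0, _ => simp [a1, a2, a3]
    | 1, _ => norm_num [a1, a2, hT0]
    | 2, _ => norm_num [a1, hT0, hT1]
    | k + 3, ih =>
      have h0 := ih k (by omega)
      have h1 := ih (k + 1) (by omega)
      have h2 := ih (k + 2) (by omega)
      have e := hK (m + ((k + 3 : ℕ) : ℤ))
      have t1 := hT (((k + 3 : ℕ) : ℤ) - 1)
      have t2 := hT (((k + 3 : ℕ) : ℤ) - 2)
      have t3 := hT (((k + 3 : ℕ) : ℤ) - 3)
      push_cast at *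
      rw [e, t1, t2, t3]
      rw [show m + ((k:ℤ) + 3) - 1 = m + (k + 2) by ring,
        show m + ((k:ℤ) + 3) - 2 = m + (k + 1) by ring,
        show m + ((k:ℤ) + 3) - 3 = m + k by ring, h0, h1, h2]
      ring_nf
end

section
/- For all integers n and m, V_{n+2m} = J_m·V_{n+m} − t^m·J_{−m}·V_n + t^m·V_{n−m}, where t^m denotes the (possibly negative) integer power of the nonzero number t. -/
lemma ch3 (M : Matrix (Fin 3) (Fin 3) ℂ) :
    M * M * M = M.trace • (M * M) - M.adjugate.trace • M + M.det • 1 := by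
  rw [Matrix.adjugate_fin_three, Matrix.det_fin_three]
  ext i j
  fin_cases i <;> fin_cases j <;>
    simp [Matrix.mul_apply, Fin.sum_univ_three, Matrix.trace] <;> ring

lemma rec_unique (r s t : ℂ) (ht : t ≠ 0) (D : ℤ → ℂ)
    (hD : ∀ n : ℤ, D n = r * D (n - 1) + s * D (n - 2) + t * D (n - 3))
    (h0 : D 0 = 0) (h1 : D 1 = 0) (h2 : D 2 = 0) (n : ℤ) : D n = 0 := by
  have key : ∀ n : ℤ, D n = 0 ∧ D (n + 1) = 0 ∧ D (n + 2) = 0 := by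
    intro n
    induction n using Int.induction_on with
    | zero => simp [h0, h1, h2]
    | succ k ih =>
      obtain ⟨a, b, c⟩ := ih
      refine ⟨b, by rw [show (k + 1 + 1 : ℤ) = k + 2 by ring, c], ?_⟩
      have h := hD (k + 3)
      rw [show (k + 3 - 1 : ℤ) = k + 2 by ring, show (k + 3 - 2 : ℤ) = k + 1 by ring,
        show (k + 3 - 3 : ℤ) = k by ring, a, b, c] at h
      rw [show (k + 1 + 2 : ℤ) = k + 3 by ring, h]; ring
    | pred k ih =>
      obtain ⟨a, b, c⟩ := ih
      have h := hD (-k + 2)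
      rw [show (-k + 2 - 1 : ℤ) = -k + 1 by ring, show (-k + 2 - 2 : ℤ) = -k by ring,
        show (-k + 2 - 3 : ℤ) = -k - 1 by ring, a, b, c] at h
      refine ⟨?_, by rw [← a]; congr 1; ring, by rw [← b]; congr 1; ring⟩
      simpa [ht] using h
  exact (key n).1

theorem generalized_tribonacci_howard_identity
    (r s t : ℂ) (ht : t ≠ 0) (V : ℤ → ℂ)
    (hV : ∀ n : ℤ, V n = r * V (n - 1) + s * V (n - 2) + t * V (n - 3))
    (J : ℤ → ℂ)
    (hJ : ∀ n : ℤ, J n = r * J (n - 1) + s * J (n - 2) + t * J (n - 3))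
    (hJ0 : J 0 = 3) (hJ1 : J 1 = r) (hJ2 : J 2 = r ^ 2 + 2 * s) :
    ∀ n m : ℤ, V (n + 2 * m) = J m * V (n + m) - t ^ m * J (-m) * V n
      + t ^ m * V (n - m) := by
  intro n m
  let A : Matrix (Fin 3) (Fin 3) ℂ := !![r, s, t; 1, 0, 0; 0, 1, 0]
  have hdet : A.det = t := by simp [A, Matrix.det_fin_three]
  have hA : IsUnit A.det := by rw [hdet]; exact ht.isUnit
  obtain ⟨U, hU⟩ := (Matrix.isUnit_iff_isUnit_det A).2 hA
  let P : ℤ → Matrix (Fin 3) (Fin 3) ℂ := fun k => ((U ^ k : (Matrix (Fin 3) (Fin 3) ℂ)ˣ) : _)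
  have Padd : ∀ a b, P (a + b) = P a * P b := fun a b => by
    simp only [P]; rw [zpow_add, Units.val_mul]
  have P0 : P 0 = 1 := by simp [P]
  have P1 : P 1 = A := by simp [P, hU]
  have hA3 : A * A * A = r • (A * A) + s • A + t • 1 := by
    ext i j
    fin_cases i <;> fin_cases j <;>
      simp [A, Matrix.mul_apply, Fin.sum_univ_three] <;> ring
  have P2 : P 2 = A * A := by rw [show (2:ℤ) = 1 + 1 by norm_num, Padd, P1]
  have P3 : P 3 = A * A * A := by rw [show (3:ℤ) = 2 + 1 by norm_num, Padd, P1, P2]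
  have Prec : ∀ k, P k = r • P (k - 1) + s • P (k - 2) + t • P (k - 3) := by
    intro k
    have e0 : P k = P (k - 3) * P 3 := by rw [← Padd]; congr 1; ring
    have e1 : P (k - 1) = P (k - 3) * P 2 := by rw [← Padd]; congr 1; ring
    have e2 : P (k - 2) = P (k - 3) * P 1 := by rw [← Padd]; congr 1; ring
    rw [e0, e1, e2, P3, P2, P1, hA3]
    simp [mul_add]
  have hT : ∀ k, J k = (P k).trace := by
    intro k
    rw [← sub_eq_zero]
    refine rec_unique r s t ht (fun k => J k - (P k).trace) ?_ ?_ ?_ ?_ k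
    · intro k
      rw [hJ k, Prec k]
      simp only [Matrix.trace_add, Matrix.trace_smul, smul_eq_mul]
      ring
    · simp [hJ0, P0]
    · simp [hJ1, P1, A, Matrix.trace, Fin.sum_univ_three]
    · simp [hJ2, P2, A, Matrix.trace, Fin.sum_univ_three, Matrix.mul_apply]; ring
  have hPd : ∀ k, (P k).det = t ^ k := by
    intro k
    change ((Units.map (Matrix.detMonoidHom (n := Fin 3) (R := ℂ)) (U ^ k) : ℂˣ) : ℂ) = _
    rw [map_zpow, Units.val_zpow_eq_zpow_val]
    congr 1
    change Matrix.det (U : Matrix (Fin 3) (Fin 3) ℂ) = t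
    rw [hU, hdet]
  have hadj : (P m).adjugate = (t ^ m) • P (-m) := by
    have h1 : P m * P (-m) = 1 := by rw [← Padd]; simp [P0]
    calc (P m).adjugate = (P m).adjugate * (P m * P (-m)) := by rw [h1, mul_one]
      _ = _ := by rw [← mul_assoc, Matrix.adjugate_mul, hPd]; simp
  -- state vector
  let v : ℤ → Fin 3 → ℂ := fun k => ![V (k + 2), V (k + 1), V k]
  have hA1 : ∀ k, A.mulVec (v k) = v (k + 1) := by
    intro k
    have h := hV (k + 3)
    rw [show (k + 3 - 1 : ℤ) = k + 2 by ring, show (k + 3 - 2 : ℤ) = k + 1 by ring,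
        show (k + 3 - 3 : ℤ) = k by ring] at h
    ext i
    fin_cases i
    · simp [A, v, show k + 1 + 2 = k + 3 by ring, h, Matrix.mulVec, dotProduct, Fin.sum_univ_three]
    · simp [A, v, show k + 1 + 1 = k + 2 by ring, Matrix.mulVec, dotProduct, Fin.sum_univ_three]
    · simp [A, v, Matrix.mulVec, dotProduct, Fin.sum_univ_three]
  have hPv : ∀ j k, (P j).mulVec (v k) = v (k + j) := by
    intro j
    induction j using Int.induction_on with
    | zero => intro k; simp [P0]
    | succ i ih =>
      intro k
      rw [Padd, ← Matrix.mulVec_mulVec, P1, hA1, ih]; congr 1; ring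
    | pred i ih =>
      intro k
      have h := ih (k - 1)
      rw [show k = (k - 1) + 1 by ring, ← hA1, ← P1, Matrix.mulVec_mulVec, ← Padd,
        show (-i - 1 + 1 : ℤ) = -i by ring, h]
      congr 1; ring
  have hc := congrArg (fun M => M.mulVec (v (n - m)) 2) (ch3 (P m))
  rw [hadj, Matrix.trace_smul, ← hT, ← hT, hPd] at hc
  simp only [Matrix.add_mulVec, Matrix.sub_mulVec, Matrix.smul_mulVec, ← Matrix.mulVec_mulVec,
    hPv, Matrix.one_mulVec, Pi.add_apply, Pi.sub_apply, Pi.smul_apply, smul_eq_mul] at hc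
  simp only [v, Matrix.cons_val] at hc
  rw [show n - m + m + m + m = n + 2 * m by ring, show n - m + m + m = n + m by ring,
    show n - m + m = n by ring] at hc
  exact hc
end

section
/- For all integers n and m, T_{n+2m} = K_m·T_{n+m} − K_{−m}·T_n + T_{n−m}. -/
theorem trib_add (T S : ℤ → ℤ)
    (hT : ∀ n : ℤ, T n = T (n - 1) + T (n - 2) + T (n - 3))
    (hT0 : T 0 = 0) (hT1 : T 1 = 1) (hT2 : T 2 = 1)
    (hS : ∀ n : ℤ, S n = S (n - 1) + S (n - 2) + S (n - 3)) (m : ℤ) :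
    ∀ n : ℤ, S (n + m) = S n * T (m - 2) + S (n + 1) * (T m - T (m - 1)) + S (n + 2) * T (m - 1) := by
  have e1 : T (-1) = 0 := by have := hT 2; norm_num at this; linarith
  have e2 : T (-2) = 1 := by have := hT 1; norm_num at this; linarith
  induction m using Int.induction_on with
  | zero => intro n; simp [e1, e2, hT0]
  | succ i ih =>
    intro n
    have h := ih (n + 1)
    have h1 := hS (n + 3)
    have h2 := hT (i + 1)
    ring_nf at h h1 h2 ⊢
    rw [h, h1, h2]; ring
  | pred i ih =>
    intro n
    have h := ih (n - 1)
    have h1 := hS (n + 2)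
    have h2 := hT (-i)
    ring_nf at h h1 h2 ⊢
    rw [h, h1, h2]; ring

theorem trib_inv (T : ℤ → ℤ)
    (hT : ∀ n : ℤ, T n = T (n - 1) + T (n - 2) + T (n - 3))
    (hT0 : T 0 = 0) (hT1 : T 1 = 1) (hT2 : T 2 = 1) (m : ℤ) :
    ∀ a b c : ℤ, a = T (m - 2) → b = T m - T (m - 1) → c = T (m - 1) →
     T (-m - 2) = (a+c)*(a+b+2*c)-(b+c)*(b+2*c) ∧
     T (-m) - T (-m - 1) = -(b*(a+b+2*c)-c*(b+2*c)) ∧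
     T (-m - 1) = b*(b+c)-c*(a+c) ∧
     a*((a+c)*(a+b+2*c)-(b+c)*(b+2*c)) - b*(c*(a+b+2*c)-(b+c)*(b+c)) + c*(c*(b+2*c)-(a+c)*(b+c)) = 1 := by
  have e1 : T (-1) = 0 := by have := hT 2; norm_num at this; linarith
  have e2 : T (-2) = 1 := by have := hT 1; norm_num at this; linarith
  induction m using Int.induction_on with
  | zero => rintro a b c rfl rfl rfl; simp [e1, e2, hT0]
  | succ i ih =>
    rintro a b c rfl rfl rfl
    obtain ⟨h1, h2, h3, h4⟩ := ih _ _ _ rfl rfl rfl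
    have k1 := hT (i + 1)
    have k2 := hT (-i)
    ring_nf at h1 h2 h3 h4 k1 k2 ⊢
    rw [k1]
    refine ⟨?_, ?_, ?_, ?_⟩
    · linarith
    · linarith
    · linarith
    · linarith
  | pred i ih =>
    rintro a b c rfl rfl rfl
    obtain ⟨h1, h2, h3, h4⟩ := ih _ _ _ rfl rfl rfl
    have k1 := hT (-i)
    have k2 := hT (i + 1)
    ring_nf at h1 h2 h3 h4 k1 k2 ⊢
    rw [k1] at h1 h2 h3 h4
    refine ⟨?_, ?_, ?_, ?_⟩
    · linarith
    · linarith
    · linarith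
    · linarith

theorem tribonacci_howard_identity
    (T K : ℤ → ℤ)
    (hT : ∀ n : ℤ, T n = T (n - 1) + T (n - 2) + T (n - 3))
    (hT0 : T 0 = 0) (hT1 : T 1 = 1) (hT2 : T 2 = 1)
    (hK : ∀ n : ℤ, K n = K (n - 1) + K (n - 2) + K (n - 3))
    (hK0 : K 0 = 3) (hK1 : K 1 = 1) (hK2 : K 2 = 3) :
    ∀ n m : ℤ, T (n + 2 * m) = K m * T (n + m) - K (-m) * T n + T (n - m) := by
  intro n m
  have A := trib_add T T hT hT0 hT1 hT2 hT m
  have Km := trib_add T K hT hT0 hT1 hT2 hK m 0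
  have Kn := trib_add T K hT hT0 hT1 hT2 hK (-m) 0
  obtain ⟨h1, h2, h3, h4⟩ := trib_inv T hT hT0 hT1 hT2 m _ _ _ rfl rfl rfl
  rw [h1, h2, h3] at Kn
  simp only [zero_add, hK0, hK1, hK2] at Km Kn
  generalize T (m - 2) = a at *
  generalize T m - T (m - 1) = b at *
  generalize T (m - 1) = c at *
  have y3 := hT (n - m + 3)
  have y4 := hT (n - m + 4)
  have a0 := A (n - m)
  have a1 := A (n - m + 1)
  have a2 := A (n - m + 2)
  have b0 := A n
  have b1 := A (n + 1)
  have b2 := A (n + 2)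
  have c0 := A (n + m)
  have z3 := hT (n + 3)
  have z4 := hT (n + 4)
  rw [Km, Kn]
  clear A Km Kn h1 h2 h3 hT hK
  ring_nf at y3 y4 a0 a1 a2 b0 b1 b2 c0 z3 z4 ⊢
  simp only [c0, b0, b1, b2, z4, z3, a0, a1, a2, y4, y3]
  linear_combination T (n - m) * h4
end

section
/- For all integers n and m, K_{n+2m} = K_m·K_{n+m} − K_{−m}·K_n + K_{n−m}. -/
def tribM : (Matrix (Fin 3) (Fin 3) ℤ)ˣ where
  val := !![1,1,1;1,0,0;0,1,0]
  inv := !![0,1,0;0,0,1;1,-1,-1]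
  val_inv := by decide
  inv_val := by decide

lemma ch3_s15 (A : Matrix (Fin 3) (Fin 3) ℤ) (h : A.det = 1) :
    A * A = A.trace • A - A.adjugate.trace • (1 : Matrix (Fin 3) (Fin 3) ℤ) + A.adjugate := by
  have ht := Matrix.trace_fin_three A
  have ha := Matrix.trace_fin_three A.adjugate
  generalize A.trace = t at *
  generalize A.adjugate.trace = s at *
  rw [Matrix.adjugate_fin_three] at ha ⊢
  simp at ha
  ext i j
  rw [Matrix.add_apply, Matrix.sub_apply, Matrix.smul_apply, Matrix.smul_apply,
    smul_eq_mul, smul_eq_mul, Matrix.mul_apply, Fin.sum_univ_three]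
  subst ht ha
  fin_cases i <;> fin_cases j <;> simp <;> ring

lemma tribM_det (m : ℤ) : ((tribM ^ m : (Matrix (Fin 3) (Fin 3) ℤ)ˣ) : Matrix (Fin 3) (Fin 3) ℤ).det = 1 := by
  have h1 : Units.map (Matrix.detMonoidHom (n := Fin 3) (R := ℤ)) tribM = 1 := by
    ext
    simp [tribM, Matrix.det_fin_three]
  have h2 : Units.map (Matrix.detMonoidHom (n := Fin 3) (R := ℤ)) (tribM ^ m) = 1 := by
    rw [map_zpow, h1, one_zpow]
  exact congrArg Units.val h2

lemma ch_unit (u : (Matrix (Fin 3) (Fin 3) ℤ)ˣ) (h : (u : Matrix (Fin 3) (Fin 3) ℤ).det = 1) :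
    (u.val * u.val) = u.val.trace • u.val - (u⁻¹).val.trace • (1 : Matrix (Fin 3) (Fin 3) ℤ) + (u⁻¹).val := by
  have : (u⁻¹).val = u.val.adjugate := by
    have h3 : u.val * u.val.adjugate = 1 := by rw [Matrix.mul_adjugate, h, one_smul]
    calc (u⁻¹).val = (u⁻¹).val * (u.val * u.val.adjugate) := by rw [h3, mul_one]
      _ = _ := by rw [← mul_assoc, Units.inv_mul, one_mul]
  rw [this]
  exact ch3_s15 _ h

def tribT (n : ℤ) : ℤ := (tribM ^ n).val.trace

lemma tribT_rec (n : ℤ) : tribT (n + 3) = tribT (n + 2) + tribT (n + 1) + tribT n := by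
  have h : tribM.val ^ 3 = tribM.val ^ 2 + tribM.val + 1 := by
    simp only [tribM]; decide
  have e3 : (tribM ^ (n+3)).val = (tribM ^ n).val * tribM.val ^ 3 := by
    rw [zpow_add]; rfl
  have e2 : (tribM ^ (n+2)).val = (tribM ^ n).val * tribM.val ^ 2 := by
    rw [zpow_add]; rfl
  have e1 : (tribM ^ (n+1)).val = (tribM ^ n).val * tribM.val := by
    rw [zpow_add, zpow_one]; rfl
  simp only [tribT]
  rw [e3, e2, e1, h, mul_add, mul_add, mul_one, Matrix.trace_add, Matrix.trace_add]

lemma tribT_id (n m : ℤ) :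
    tribT (n + 2 * m) = tribT m * tribT (n + m) - tribT (-m) * tribT n + tribT (n - m) := by
  have h := ch_unit (tribM ^ m) (tribM_det m)
  have h' := congrArg (fun X => ((tribM ^ n).val * X).trace) h
  simp only [mul_add, mul_sub, Matrix.trace_add, Matrix.trace_sub, Matrix.mul_smul,
    Matrix.trace_smul, mul_one, ← Units.val_mul, ← zpow_neg, ← zpow_add, smul_eq_mul] at h'
  simp only [tribT, sub_eq_add_neg n m, two_mul]
  exact h'

theorem tribonacci_lucas_howard_identity
    (K : ℤ → ℤ)
    (hK : ∀ n : ℤ, K n = K (n - 1) + K (n - 2) + K (n - 3))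
    (hK0 : K 0 = 3) (hK1 : K 1 = 1) (hK2 : K 2 = 3) :
    ∀ n m : ℤ, K (n + 2 * m) = K m * K (n + m) - K (-m) * K n + K (n - m) := by
  have hR : ∀ n, K (n + 3) = K (n + 2) + K (n + 1) + K n := by
    intro n
    have := hK (n + 3)
    rwa [show n + 3 - 1 = n + 2 by ring, show n + 3 - 2 = n + 1 by ring,
      show n + 3 - 3 = n by ring] at this
  have key : ∀ n : ℤ, K n = tribT n ∧ K (n + 1) = tribT (n + 1) ∧ K (n + 2) = tribT (n + 2) := by
    intro n
    induction n using Int.induction_on with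
    | zero =>
      refine ⟨?_, ?_, ?_⟩
      · rw [hK0]; decide
      · rw [zero_add, hK1]; decide
      · rw [zero_add, hK2]; decide
    | succ i ih =>
      obtain ⟨a, b, c⟩ := ih
      have h1 := hR i
      have h2 := tribT_rec i
      rw [show (i : ℤ) + 1 + 1 = i + 2 by ring, show (i : ℤ) + 1 + 2 = i + 3 by ring]
      exact ⟨b, c, by linarith⟩
    | pred i ih =>
      obtain ⟨a, b, c⟩ := ih
      have h1 := hR (-i - 1)
      have h2 := tribT_rec (-i - 1)
      rw [show -(i : ℤ) - 1 + 1 = -i by ring, show -(i : ℤ) - 1 + 2 = -i + 1 by ring,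
        show -(i : ℤ) - 1 + 3 = -i + 2 by ring] at h1 h2
      rw [show -(i : ℤ) - 1 + 1 = -i by ring, show -(i : ℤ) - 1 + 2 = -i + 1 by ring]
      exact ⟨by linarith, a, b⟩
  have : K = tribT := funext fun n => (key n).1
  rw [this]
  exact tribT_id
end

section
/- For every integer n, the determinant of the 4×4 matrix whose rows are (X_n, Y_n, Y_{n+1}, Y_{n+2}), (X_2, Y_2, Y_3, Y_4), (X_1, Y_1, Y_2, Y_3), (X_0, Y_0, Y_1, Y_2) is zero. -/
theorem rec_zero_aux (r s t : ℝ) (ht : t ≠ 0) (Z : ℤ → ℝ)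
    (hZ : ∀ n : ℤ, Z n = r * Z (n - 1) + s * Z (n - 2) + t * Z (n - 3))
    (h0 : Z 0 = 0) (h1 : Z 1 = 0) (h2 : Z 2 = 0) (n : ℤ) : Z n = 0 := by
  have key : ∀ n : ℤ, Z n = 0 ∧ Z (n + 1) = 0 ∧ Z (n + 2) = 0 := by
    intro n
    induction n using Int.induction_on with
    | zero => exact ⟨h0, by simpa using h1, by simpa using h2⟩
    | succ k ih =>
      obtain ⟨a, b, c⟩ := ih
      refine ⟨b, by rw [← c]; congr 1, ?_⟩
      rw [hZ, show (k : ℤ) + 1 + 2 - 1 = k + 2 by ring, show (k : ℤ) + 1 + 2 - 2 = k + 1 by ring,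
        show (k : ℤ) + 1 + 2 - 3 = k by ring, a, b, c]
      ring
    | pred k ih =>
      obtain ⟨a, b, c⟩ := ih
      refine ⟨?_, by rw [← a]; congr 1; ring, by rw [← b]; congr 1; ring⟩
      have h := hZ (-(k : ℤ) + 2)
      rw [show -(k : ℤ) + 2 - 1 = -k + 1 by ring, show -(k : ℤ) + 2 - 2 = -k by ring,
        show -(k : ℤ) + 2 - 3 = -k - 1 by ring, a, b, c] at h
      have h' : t * Z (-(k : ℤ) - 1) = 0 := by linarith
      exact (mul_eq_zero.mp h').resolve_left ht
  exact (key n).1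

theorem det_lin_aux (p q u : Fin 4 → ℝ) : ∃ a b c d : ℝ, ∀ x y z w : ℝ,
    Matrix.det !![x, y, z, w; p 0, p 1, p 2, p 3; q 0, q 1, q 2, q 3; u 0, u 1, u 2, u 3]
      = a * x + b * y + c * z + d * w := by
  let f := fun x y z w : ℝ => Matrix.det
    !![x, y, z, w; p 0, p 1, p 2, p 3; q 0, q 1, q 2, q 3; u 0, u 1, u 2, u 3]
  refine ⟨f 1 0 0 0, f 0 1 0 0, f 0 0 1 0, f 0 0 0 1, ?_⟩
  intro x y z w
  simp [f, Matrix.det_succ_row_zero, Fin.sum_univ_succ, Fin.succAbove]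
  ring

theorem melham_determinant_vanishes
    (r s t : ℝ) (ht : t ≠ 0) (X Y : ℤ → ℝ)
    (hX : ∀ n : ℤ, X n = r * X (n - 1) + s * X (n - 2) + t * X (n - 3))
    (hY : ∀ n : ℤ, Y n = r * Y (n - 1) + s * Y (n - 2) + t * Y (n - 3)) :
    ∀ n : ℤ,
      Matrix.det !![X n, Y n, Y (n + 1), Y (n + 2);
                    X 2, Y 2, Y 3, Y 4;
                    X 1, Y 1, Y 2, Y 3;
                    X 0, Y 0, Y 1, Y 2] = 0 := by
  obtain ⟨a, b, c, d, h⟩ := det_lin_aux ![X 2, Y 2, Y 3, Y 4] ![X 1, Y 1, Y 2, Y 3]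
    ![X 0, Y 0, Y 1, Y 2]
  have h' : ∀ x y z w : ℝ, Matrix.det !![x, y, z, w;
                    X 2, Y 2, Y 3, Y 4;
                    X 1, Y 1, Y 2, Y 3;
                    X 0, Y 0, Y 1, Y 2] = a * x + b * y + c * z + d * w := h
  intro n
  refine rec_zero_aux r s t ht (fun n => Matrix.det !![X n, Y n, Y (n + 1), Y (n + 2);
                    X 2, Y 2, Y 3, Y 4;
                    X 1, Y 1, Y 2, Y 3;
                    X 0, Y 0, Y 1, Y 2]) ?_ ?_ ?_ ?_ n
  · intro m
    simp only [h']
    have e1 := hY (m + 1)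
    have e2 := hY (m + 2)
    rw [show m + 1 - 1 = m - 1 + 1 by ring, show m + 1 - 2 = m - 2 + 1 by ring,
      show m + 1 - 3 = m - 3 + 1 by ring] at e1
    rw [show m + 2 - 1 = m - 1 + 2 by ring, show m + 2 - 2 = m - 2 + 2 by ring,
      show m + 2 - 3 = m - 3 + 2 by ring] at e2
    linear_combination a * hX m + b * hY m + c * e1 + d * e2
  · exact Matrix.det_zero_of_row_eq (i := 0) (j := 3) (by decide) (by
      ext j; fin_cases j <;> simp)
  · exact Matrix.det_zero_of_row_eq (i := 0) (j := 2) (by decide) (by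
      ext j; fin_cases j <;> simp)
  · exact Matrix.det_zero_of_row_eq (i := 0) (j := 1) (by decide) (by
      ext j; fin_cases j <;> simp)
end

section
/- For every integer n, 44·T_n = 10·K_{n+2} − 6·K_{n+1} − 8·K_n. -/
theorem tribonacci_from_tribonacci_lucas
    (T K : ℤ → ℤ)
    (hT : ∀ n : ℤ, T n = T (n - 1) + T (n - 2) + T (n - 3))
    (hT0 : T 0 = 0) (hT1 : T 1 = 1) (hT2 : T 2 = 1)
    (hK : ∀ n : ℤ, K n = K (n - 1) + K (n - 2) + K (n - 3))
    (hK0 : K 0 = 3) (hK1 : K 1 = 1) (hK2 : K 2 = 3) :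
    ∀ n : ℤ, 44 * T n = 10 * K (n + 2) - 6 * K (n + 1) - 8 * K n := by
  have step : ∀ F : ℤ → ℤ, (∀ n : ℤ, F n = F (n - 1) + F (n - 2) + F (n - 3)) →
      ∀ n, F (n + 3) = F (n + 2) + F (n + 1) + F n := by
    intro F hF n
    have h := hF (n + 3)
    rwa [show n + 3 - 1 = n + 2 by ring, show n + 3 - 2 = n + 1 by ring,
      show n + 3 - 3 = n by ring] at h
  have key : ∀ D : ℤ → ℤ, (∀ n, D (n + 3) = D (n + 2) + D (n + 1) + D n) →
      D 0 = 0 → D 1 = 0 → D 2 = 0 → ∀ n, D n = 0 ∧ D (n + 1) = 0 ∧ D (n + 2) = 0 := by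
    intro D hD h0 h1 h2 n
    induction n using Int.induction_on with
    | zero => exact ⟨h0, by simpa using h1, by simpa using h2⟩
    | succ i ih =>
      obtain ⟨a, b, c⟩ := ih
      have h := hD i
      rw [show (i : ℤ) + 1 + 1 = i + 2 by ring, show (i : ℤ) + 1 + 2 = i + 3 by ring]
      exact ⟨b, c, by linarith⟩
    | pred i ih =>
      obtain ⟨a, b, c⟩ := ih
      have h := hD (-i - 1)
      rw [show -(i : ℤ) - 1 + 3 = -i + 2 by ring, show -(i : ℤ) - 1 + 2 = -i + 1 by ring,
        show -(i : ℤ) - 1 + 1 = -i by ring] at h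
      rw [show -(i : ℤ) - 1 + 2 = -i + 1 by ring, show -(i : ℤ) - 1 + 1 = -i by ring]
      exact ⟨by linarith, a, b⟩
  have sT := step T hT
  have sK := step K hK
  have k3 : K 3 = 7 := by have := sK 0; norm_num at this; linarith
  have k4 : K 4 = 11 := by have := sK 1; norm_num at this; linarith
  intro n
  have h := (key (fun n => 44 * T n - (10 * K (n + 2) - 6 * K (n + 1) - 8 * K n)) ?_ ?_ ?_ ?_ n).1
  · clear step key
    linarith
  · intro m
    have e1 := sT m
    have e2 := sK m
    have e3 := sK (m + 1)
    have e4 := sK (m + 2)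
    ring_nf at e1 e2 e3 e4 ⊢
    linarith
  · norm_num [hT0, hK0, hK1, hK2]
  · norm_num [hT1, hK1, hK2, k3]
  · norm_num [hT2, hK2, k3, k4]
end

section
/- For every integer n, K_n = −T_{n+2} + 4·T_{n+1} − T_n. -/
theorem tribonacci_lucas_from_tribonacci
    (T K : ℤ → ℤ)
    (hT : ∀ n : ℤ, T n = T (n - 1) + T (n - 2) + T (n - 3))
    (hT0 : T 0 = 0) (hT1 : T 1 = 1) (hT2 : T 2 = 1)
    (hK : ∀ n : ℤ, K n = K (n - 1) + K (n - 2) + K (n - 3))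
    (hK0 : K 0 = 3) (hK1 : K 1 = 1) (hK2 : K 2 = 3) :
    ∀ n : ℤ, K n = -T (n + 2) + 4 * T (n + 1) - T n := by
  have hT' : ∀ m : ℤ, T (m + 3) = T (m + 2) + T (m + 1) + T m := by
    intro m
    have h := hT (m + 3)
    rwa [show m + 3 - 1 = m + 2 by ring, show m + 3 - 2 = m + 1 by ring,
      show m + 3 - 3 = m by ring] at h
  have hK' : ∀ m : ℤ, K (m + 3) = K (m + 2) + K (m + 1) + K m := by
    intro m
    have h := hK (m + 3)
    rwa [show m + 3 - 1 = m + 2 by ring, show m + 3 - 2 = m + 1 by ring,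
      show m + 3 - 3 = m by ring] at h
  obtain ⟨D, hD⟩ : ∃ D : ℤ → ℤ, ∀ n, D n = K n + T (n + 2) - 4 * T (n + 1) + T n :=
    ⟨_, fun _ => rfl⟩
  have hDr : ∀ m : ℤ, D (m + 3) = D (m + 2) + D (m + 1) + D m := by
    intro m
    have h0 := hT' m
    have h1 := hT' (m + 1)
    have h2 := hT' (m + 2)
    have hk := hK' m
    simp only [hD]
    ring_nf at h0 h1 h2 hk ⊢
    linarith
  have t3 := hT' 0
  have t4 := hT' 1
  norm_num at t3 t4
  have key : ∀ n : ℤ, D n = 0 ∧ D (n + 1) = 0 ∧ D (n + 2) = 0 := by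
    intro n
    induction n using Int.induction_on with
    | zero =>
      simp only [hD]
      norm_num
      refine ⟨?_, ?_, ?_⟩ <;> linarith
    | succ i ih =>
      obtain ⟨a, b, c⟩ := ih
      have h := hDr i
      refine ⟨b, ?_, ?_⟩
      · rw [show (i : ℤ) + 1 + 1 = i + 2 by ring]; exact c
      · rw [show (i : ℤ) + 1 + 2 = i + 3 by ring]; linarith
    | pred i ih =>
      obtain ⟨a, b, c⟩ := ih
      have h := hDr (-(i : ℤ) - 1)
      rw [show -(i : ℤ) - 1 + 3 = -i + 2 by ring, show -(i : ℤ) - 1 + 2 = -i + 1 by ring,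
        show -(i : ℤ) - 1 + 1 = -i by ring] at h
      refine ⟨by linarith, ?_, ?_⟩
      · rw [show -(i : ℤ) - 1 + 1 = -i by ring]; exact a
      · rw [show -(i : ℤ) - 1 + 2 = -i + 1 by ring]; exact b
  intro n
  have h := (key n).1
  rw [hD] at h
  linarith
end
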